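/- arXiv:2512.22163 — 3 statements merged into one kernel-verified Lean document; each statement's English description precedes it below -/
import Mathlib

section
/- Let M₁, M₂ > 0 and ε ∈ (0,1) be given and set R₁ = ⌊r(eM₁/4, 5ε/12)⌋ and R₂ = ⌊r(eM₂/2, 5ε/8)/2⌋, where r(t, ε') is the unique r > t with (t/r)^r = ε'. Let E_{R₁}(x; M₁) = e^{−M₁/2} I_0(M₁/2) + 2 e^{−M₁/2} Σ_{n=1}^{R₁} (−1)^n I_n(M₁/2) T_{2n}(x), C_{R₂}(x; M₂) = J_0(M₂) + 2 Σ_{k=1}^{R₂} (−1)^k J_{2k}(M₂) T_{2k}(x), and S_{R₂}(x; M₂) = 2 Σ_{k=0}^{R₂} (−1)^k J_{2k+1}(M₂) T_{2k+1}(x). Then |E_{R₁}(x; M₁) C_{R₂}(x; M₂) − e^{−M₁x²} cos(M₂x)| ≤ ε and |E_{R₁}(x; M₁) S_{R₂}(x; M₂) − e^{−M₁x²} sin(M₂x)| ≤ ε for all x ∈ [−1,1]. -/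
open Real Polynomial

/-- The Bessel function of the first kind `J_n(x) = Σ_k (−1)^k (x/2)^{n+2k}/(k!(n+k)!)`. -/
noncomputable def besselJ (n : ℕ) (x : ℝ) : ℝ :=
  ∑' k : ℕ, (-1 : ℝ) ^ k * (x / 2) ^ (n + 2 * k) / (k.factorial * (n + k).factorial)

/-- The modified Bessel function of the first kind
`I_n(y) = Σ_k (y/2)^{n+2k}/(k!(n+k)!)`. -/
noncomputable def besselI (n : ℕ) (y : ℝ) : ℝ :=
  ∑' k : ℕ, (y / 2) ^ (n + 2 * k) / (k.factorial * (n + k).factorial)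

/-- `E_R(x; M) = e^{−M/2} I_0(M/2) + 2 e^{−M/2} Σ_{n=1}^R (−1)^n I_n(M/2) T_{2n}(x)`. -/
noncomputable def gaussTrunc (R : ℕ) (M x : ℝ) : ℝ :=
  Real.exp (-M / 2) * besselI 0 (M / 2) +
    2 * Real.exp (-M / 2) * ∑ n ∈ Finset.Icc 1 R,
      (-1 : ℝ) ^ n * besselI n (M / 2) * (Chebyshev.T ℝ (2 * n : ℤ)).eval x

/-- `C_R(x; M) = J_0(M) + 2 Σ_{k=1}^R (−1)^k J_{2k}(M) T_{2k}(x)`. -/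
noncomputable def jaCos (R : ℕ) (M x : ℝ) : ℝ :=
  besselJ 0 M + 2 * ∑ k ∈ Finset.Icc 1 R,
    (-1 : ℝ) ^ k * besselJ (2 * k) M * (Chebyshev.T ℝ (2 * k : ℤ)).eval x

/-- `S_R(x; M) = 2 Σ_{k=0}^R (−1)^k J_{2k+1}(M) T_{2k+1}(x)`. -/
noncomputable def jaSin (R : ℕ) (M x : ℝ) : ℝ :=
  2 * ∑ k ∈ Finset.range (R + 1),
    (-1 : ℝ) ^ k * besselJ (2 * k + 1) M * (Chebyshev.T ℝ (2 * k + 1 : ℤ)).eval x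

theorem summable_bessel_series {𝕂 : Type*} [RCLike 𝕂] (n : ℕ) (u : 𝕂) :
    Summable fun k : ℕ => u ^ (n + 2 * k) / ((k.factorial : 𝕂) * (n + k).factorial) := by
  refine Summable.of_norm_bounded
    ((Real.summable_pow_div_factorial (‖u‖ ^ 2)).mul_left (‖u‖ ^ n)) fun k => ?_
  rw [norm_div, norm_mul, norm_pow, RCLike.norm_natCast, RCLike.norm_natCast, pow_add, pow_mul,
    mul_div_assoc]
  have h : (1 : ℝ) ≤ (n + k).factorial := by exact_mod_cast (n + k).factorial_pos
  have hk : (0 : ℝ) < k.factorial := by exact_mod_cast k.factorial_pos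
  gcongr
  nlinarith

/-- The modified Bessel function as a function of half its complex argument. -/
noncomputable def besselHalf (n : ℕ) (u : ℂ) : ℂ :=
  ∑' k : ℕ, u ^ (n + 2 * k) / ((k.factorial : ℂ) * (n + k).factorial)

theorem Complex.hasSum_pow_div_factorial (x : ℂ) :
    HasSum (fun n : ℕ => x ^ n / n.factorial) (Complex.exp x) := by
  rw [Complex.exp_eq_exp_ℂ]
  exact NormedSpace.expSeries_div_hasSum_exp x

theorem Real.hasSum_pow_div_factorial (x : ℝ) :
    HasSum (fun n : ℕ => x ^ n / n.factorial) (Real.exp x) := by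
  rw [Real.exp_eq_exp_ℝ]
  exact NormedSpace.expSeries_div_hasSum_exp x

/-- A pair of naturals is determined by its difference and its minimum. -/
def natProdEquivDiffMin : ℤ × ℕ ≃ ℕ × ℕ where
  toFun p := (p.2 + p.1.toNat, p.2 + (-p.1).toNat)
  invFun p := ((p.1 : ℤ) - p.2, min p.1 p.2)
  left_inv := by
    rintro ⟨n, k⟩
    ext <;> simp
    omega
  right_inv := by
    rintro ⟨a, b⟩
    ext <;> simp <;> omega

theorem hasSum_exp_mul_add (u z w : ℂ) : HasSum (fun p : ℕ × ℕ =>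
    (u * z) ^ p.1 / p.1.factorial * ((u * w) ^ p.2 / p.2.factorial))
    (Complex.exp (u * (z + w))) := by
  rw [mul_add, Complex.exp_add]
  have hs (x : ℂ) : Summable fun n : ℕ => ‖x ^ n / (n.factorial : ℂ)‖ := by
    simpa using Real.summable_pow_div_factorial ‖x‖
  exact HasSum.mul (f := fun n : ℕ => (u * z) ^ n / (n.factorial : ℂ))
    (g := fun n : ℕ => (u * w) ^ n / (n.factorial : ℂ))
    (Complex.hasSum_pow_div_factorial _) (Complex.hasSum_pow_div_factorial _)
    (summable_mul_of_summable_norm (f := fun n : ℕ => (u * z) ^ n / (n.factorial : ℂ))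
      (g := fun n : ℕ => (u * w) ^ n / (n.factorial : ℂ)) (hs _) (hs _))

theorem exp_series_term_eq_bessel_term (u : ℂ) {z w : ℂ} (h : z * w = 1) (n : ℤ) (k : ℕ) :
    (u * z) ^ (k + n.toNat) / ((k + n.toNat).factorial : ℂ) *
        ((u * w) ^ (k + (-n).toNat) / ((k + (-n).toNat).factorial : ℂ)) =
      u ^ (n.natAbs + 2 * k) / ((k.factorial : ℂ) * (n.natAbs + k).factorial) *
        (z ^ n.toNat * w ^ (-n).toNat) := by
  have hk : z ^ k * w ^ k = 1 := by rw [← mul_pow, h, one_pow]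
  obtain ⟨m, rfl | rfl⟩ := n.eq_nat_or_neg
  · simp only [Int.toNat_natCast, Int.toNat_neg_natCast, Int.natAbs_natCast, add_zero, pow_zero,
      mul_one, mul_pow, pow_add, add_comm m k, pow_mul]
    linear_combination (u ^ k * u ^ m * z ^ m * u ^ k /
      ((k + m).factorial * k.factorial : ℂ)) * hk
  · simp only [neg_neg, Int.toNat_natCast, Int.toNat_neg_natCast, Int.natAbs_neg,
      Int.natAbs_natCast, add_zero, pow_zero, one_mul, mul_pow, pow_add, add_comm m k, pow_mul]
    linear_combination (u ^ k * u ^ m * w ^ m * u ^ k /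
      ((k + m).factorial * k.factorial : ℂ)) * hk

theorem hasSum_besselHalf (u z w : ℂ) (h : z * w = 1) :
    HasSum (fun n : ℕ => besselHalf n u * (z ^ n + w ^ n))
      (Complex.exp (u * (z + w)) + besselHalf 0 u) := by
  have hdiff : HasSum (fun p : ℤ × ℕ =>
      u ^ (p.1.natAbs + 2 * p.2) / ((p.2.factorial : ℂ) * (p.1.natAbs + p.2).factorial) *
        (z ^ p.1.toNat * w ^ (-p.1).toNat)) (Complex.exp (u * (z + w))) := by
    have hprod := natProdEquivDiffMin.hasSum_iff.2 (hasSum_exp_mul_add u z w)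
    convert hprod using 1
    ext p
    exact (exp_series_term_eq_bessel_term u h p.1 p.2).symm
  have hfib (n : ℤ) : HasSum (fun k : ℕ =>
      u ^ (n.natAbs + 2 * k) / ((k.factorial : ℂ) * (n.natAbs + k).factorial) *
        (z ^ n.toNat * w ^ (-n).toNat))
      (besselHalf n.natAbs u * (z ^ n.toNat * w ^ (-n).toNat)) :=
    (summable_bessel_series n.natAbs u).hasSum.mul_right _
  have key := hdiff.prod_fiberwise hfib
  have := key.nat_add_neg
  convert this using 1
  · ext n
    simp
    ring
  · simp

/-- `∑ (-t)^k / (k! (n+k)!)`, so that `J_n(x) = (x/2)^n besselReduced n (x²/4)`. -/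
noncomputable def besselReduced (n : ℕ) (t : ℝ) : ℝ :=
  ∑' k : ℕ, (-t) ^ k / ((k.factorial : ℝ) * (n + k).factorial)

theorem summable_besselReduced (n : ℕ) (t : ℝ) :
    Summable fun k : ℕ => (-t) ^ k / ((k.factorial : ℝ) * (n + k).factorial) := by
  refine Summable.of_norm_bounded (Real.summable_pow_div_factorial |t|) fun k => ?_
  rw [norm_div, norm_mul, norm_pow, RCLike.norm_natCast, RCLike.norm_natCast, norm_neg,
    Real.norm_eq_abs]
  have h : (1 : ℝ) ≤ (n + k).factorial := by exact_mod_cast (n + k).factorial_pos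
  have hk : (0 : ℝ) < k.factorial := by exact_mod_cast k.factorial_pos
  gcongr
  nlinarith

theorem besselReduced_zero (n : ℕ) : besselReduced n 0 = 1 / n.factorial := by
  rw [besselReduced, tsum_eq_single 0]
  · simp
  · intro k hk
    simp [hk]

theorem besselReduced_recurrence (n : ℕ) (t : ℝ) :
    besselReduced n t = (n + 1) * besselReduced (n + 1) t - t * besselReduced (n + 2) t := by
  have h1 := ((summable_besselReduced (n + 1) t).hasSum.mul_left ((n : ℝ) + 1))
  have h2 : HasSum (fun k : ℕ => k * ((-t) ^ k / ((k.factorial : ℝ) * (n + 1 + k).factorial)))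
      (-t * besselReduced (n + 2) t) := by
    rw [← hasSum_nat_add_iff' 1]
    convert! (summable_besselReduced (n + 2) t).hasSum.mul_left (-t) using 1
    · ext k
      rw [show n + 1 + (k + 1) = n + 2 + k by ring, Nat.factorial_succ k]
      have := Nat.factorial_ne_zero k
      have := Nat.factorial_ne_zero (n + 2 + k)
      push_cast
      field_simp
      ring
    · simp [besselReduced]
  rw [sub_eq_add_neg, ← neg_mul]
  refine HasSum.unique ?_ (h1.add h2)
  convert! (summable_besselReduced n t).hasSum using 1
  ext k
  rw [show n + 1 + k = (n + k) + 1 by ring, Nat.factorial_succ (n + k)]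
  have := Nat.factorial_ne_zero k
  have := Nat.factorial_ne_zero (n + k)
  push_cast
  field_simp
  ring

theorem hasDerivAt_besselReduced (n : ℕ) (t : ℝ) :
    HasDerivAt (besselReduced n) (-besselReduced (n + 1) t) t := by
  have hshift (x : ℝ) (k : ℕ) :
      -(((k + 1 : ℕ) : ℝ) * x ^ k) / (((k + 1).factorial : ℝ) * (n + (k + 1)).factorial) =
        -(x ^ k / ((k.factorial : ℝ) * (n + 1 + k).factorial)) := by
    rw [show n + (k + 1) = n + 1 + k by ring, Nat.factorial_succ k]
    have := Nat.factorial_ne_zero k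
    have := Nat.factorial_ne_zero (n + 1 + k)
    push_cast
    field_simp
  have hderiv := hasDerivAt_tsum_of_isPreconnected (𝕜 := ℝ) (F := ℝ)
    (g := fun (k : ℕ) (t : ℝ) => (-t) ^ k / ((k.factorial : ℝ) * (n + k).factorial))
    (g' := fun (k : ℕ) (t : ℝ) =>
      -((k : ℝ) * (-t) ^ (k - 1)) / ((k.factorial : ℝ) * (n + k).factorial))
    (u := fun k : ℕ => (k : ℝ) * (|t| + 1) ^ (k - 1) / k.factorial)
    (t := Metric.ball 0 (|t| + 1)) (y₀ := 0) (y := t) ?_ Metric.isOpen_ball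
    (convex_ball _ _).isPreconnected ?_ ?_ (by simp; positivity) (summable_besselReduced n 0)
    (by simp)
  · refine hderiv.congr_deriv ?_
    rw [besselReduced, ← tsum_neg]
    refine HasSum.tsum_eq ?_
    rw [← hasSum_nat_add_iff' 1]
    convert! (summable_besselReduced (n + 1) t).neg.hasSum using 1
    · ext k
      exact hshift _ k
    · simp
  · rw [← summable_nat_add_iff 1]
    refine (Real.summable_pow_div_factorial (|t| + 1)).congr fun k => ?_
    rw [Nat.factorial_succ]
    have := Nat.factorial_ne_zero k
    rw [Nat.add_sub_cancel]
    push_cast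
    field_simp
  · intro k y _
    refine HasDerivAt.div_const ?_ _
    refine ((hasDerivAt_id y).neg.pow k).congr_deriv ?_
    simp
  · intro k y hy
    rw [norm_div, norm_mul, norm_neg, norm_mul, norm_pow, RCLike.norm_natCast,
      RCLike.norm_natCast, RCLike.norm_natCast, norm_neg]
    have h : (1 : ℝ) ≤ (n + k).factorial := by exact_mod_cast (n + k).factorial_pos
    have hk : (0 : ℝ) < k.factorial := by exact_mod_cast k.factorial_pos
    have hy' : ‖y‖ ≤ |t| + 1 := by simpa using (mem_ball_zero_iff.1 hy).le
    gcongr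
    nlinarith

theorem abs_besselReduced_le (n : ℕ) {t : ℝ} (ht : 0 ≤ t) :
    |besselReduced n t| ≤ 1 / n.factorial := by
  have hd (x : ℝ) : HasDerivAt (fun x => besselReduced n x ^ 2 + x * besselReduced (n + 1) x ^ 2)
      (-(2 * n + 1) * besselReduced (n + 1) x ^ 2) x := by
    refine (((hasDerivAt_besselReduced n x).pow 2).add
      ((hasDerivAt_id x).mul ((hasDerivAt_besselReduced (n + 1) x).pow 2))).congr_deriv ?_
    simp only [besselReduced_recurrence n x, id, Pi.pow_apply]
    push_cast
    ring
  have hanti : Antitone fun x => besselReduced n x ^ 2 + x * besselReduced (n + 1) x ^ 2 := by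
    refine antitone_of_deriv_nonpos (fun x => (hd x).differentiableAt) fun x => ?_
    rw [(hd x).deriv]
    have : 0 ≤ (2 * (n : ℝ) + 1) * besselReduced (n + 1) x ^ 2 := by positivity
    linarith
  have h := hanti ht
  simp only [besselReduced_zero n, zero_mul, add_zero] at h
  refine abs_le_of_sq_le_sq ?_ (by positivity)
  nlinarith [mul_nonneg ht (sq_nonneg (besselReduced (n + 1) t))]

theorem besselJ_eq_mul_besselReduced (n : ℕ) (x : ℝ) :
    besselJ n x = (x / 2) ^ n * besselReduced n ((x / 2) ^ 2) := by
  rw [besselJ, besselReduced, ← tsum_mul_left]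
  refine tsum_congr fun k => ?_
  rw [neg_pow ((x / 2) ^ 2), ← pow_mul, pow_add]
  ring

theorem abs_besselJ_le (n : ℕ) {x : ℝ} (hx : 0 ≤ x) :
    |besselJ n x| ≤ (x / 2) ^ n / n.factorial := by
  rw [besselJ_eq_mul_besselReduced, abs_mul, abs_of_nonneg (by positivity : 0 ≤ (x / 2) ^ n),
    ← mul_one_div ((x / 2) ^ n)]
  exact mul_le_mul_of_nonneg_left (abs_besselReduced_le n (sq_nonneg _)) (by positivity)

theorem hasSum_besselHalf_cos (u : ℂ) (θ : ℝ) :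
    HasSum (fun n : ℕ => besselHalf n u * ((2 * Real.cos (n * θ) : ℝ) : ℂ))
      (Complex.exp (u * ((2 * Real.cos θ : ℝ) : ℂ)) + besselHalf 0 u) := by
  have hcos (n : ℕ) : Complex.exp (θ * Complex.I) ^ n + Complex.exp (-(θ * Complex.I)) ^ n =
      ((2 * Real.cos (n * θ) : ℝ) : ℂ) := by
    push_cast
    rw [Complex.two_cos, ← Complex.exp_nat_mul, ← Complex.exp_nat_mul]
    ring_nf
  have h := hasSum_besselHalf u (Complex.exp (θ * Complex.I)) (Complex.exp (-(θ * Complex.I)))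
    (by rw [← Complex.exp_add, add_neg_cancel, Complex.exp_zero])
  have h1 := hcos 1
  simp only [pow_one, Nat.cast_one, one_mul] at h1
  simpa only [hcos, h1] using h

theorem besselHalf_neg_ofReal (n : ℕ) (y : ℝ) :
    besselHalf n ((-(y / 2) : ℝ) : ℂ) = (((-1) ^ n * besselI n y : ℝ) : ℂ) := by
  rw [besselHalf, besselI, ← tsum_mul_left, Complex.ofReal_tsum]
  refine tsum_congr fun k => ?_
  push_cast
  rw [neg_pow, pow_add (-1 : ℂ), pow_mul (-1 : ℂ)]
  norm_num
  ring

theorem besselHalf_I_mul_ofReal (n : ℕ) (x : ℝ) :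
    besselHalf n (Complex.I * ((x / 2 : ℝ) : ℂ)) = Complex.I ^ n * ((besselJ n x : ℝ) : ℂ) := by
  rw [besselHalf, besselJ, Complex.ofReal_tsum, ← tsum_mul_left]
  refine tsum_congr fun k => ?_
  push_cast
  rw [mul_pow, pow_add Complex.I, pow_mul Complex.I, Complex.I_sq]
  ring

theorem hasSum_besselI_cos (y θ : ℝ) :
    HasSum (fun n : ℕ => (-1) ^ n * besselI n y * (2 * Real.cos (n * θ)))
      (Real.exp (-y * Real.cos θ) + besselI 0 y) := by
  have h := hasSum_besselHalf_cos ((-(y / 2) : ℝ) : ℂ) θ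
  simp only [besselHalf_neg_ofReal, ← Complex.ofReal_mul, ← Complex.ofReal_exp,
    ← Complex.ofReal_add, Complex.hasSum_ofReal] at h
  convert! h using 2
  · ring_nf
  · ring

theorem hasSum_besselJ_cos (x θ : ℝ) :
    HasSum (fun n : ℕ => Complex.I ^ n * ((besselJ n x * (2 * Real.cos (n * θ)) : ℝ) : ℂ))
      (Complex.exp (((x * Real.cos θ : ℝ) : ℂ) * Complex.I) + ((besselJ 0 x : ℝ) : ℂ)) := by
  have h := hasSum_besselHalf_cos (Complex.I * ((x / 2 : ℝ) : ℂ)) θ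
  simp only [besselHalf_I_mul_ofReal] at h
  convert! h using 2
  · push_cast
    ring
  · push_cast
    ring_nf
  · simp

theorem Complex.I_pow_two_mul (k : ℕ) : Complex.I ^ (2 * k) = (((-1) ^ k : ℝ) : ℂ) := by
  rw [pow_mul, Complex.I_sq]
  push_cast
  rfl

theorem hasSum_besselJ_even (x θ : ℝ) :
    HasSum (fun k : ℕ => (-1) ^ k * besselJ (2 * k) x * (2 * Real.cos ((2 * k : ℕ) * θ)))
      (Real.cos (x * Real.cos θ) + besselJ 0 x) := by
  have h := Complex.hasSum_re (hasSum_besselJ_cos x θ)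
  rw [Complex.add_re, Complex.exp_ofReal_mul_I_re, Complex.ofReal_re] at h
  have hinj : Function.Injective fun k : ℕ => 2 * k := fun a b hab => by simpa using hab
  rw [← hinj.hasSum_iff] at h
  · convert! h using 1
    ext k
    simp only [Function.comp, Complex.I_pow_two_mul, ← Complex.ofReal_mul, Complex.ofReal_re]
    ring
  · intro n hn
    obtain ⟨k, rfl | rfl⟩ := n.even_or_odd'
    · exact absurd ⟨k, rfl⟩ hn
    · simp only [pow_succ, Complex.I_pow_two_mul, mul_right_comm _ Complex.I,
        ← Complex.ofReal_mul, Complex.re_ofReal_mul, Complex.I_re, mul_zero]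

theorem hasSum_besselJ_odd (x θ : ℝ) :
    HasSum (fun k : ℕ =>
        (-1) ^ k * besselJ (2 * k + 1) x * (2 * Real.cos ((2 * k + 1 : ℕ) * θ)))
      (Real.sin (x * Real.cos θ)) := by
  have h := Complex.hasSum_im (hasSum_besselJ_cos x θ)
  rw [Complex.add_im, Complex.exp_ofReal_mul_I_im, Complex.ofReal_im, add_zero] at h
  have hinj : Function.Injective fun k : ℕ => 2 * k + 1 := fun a b hab => by simpa using hab
  rw [← hinj.hasSum_iff] at h
  · convert! h using 1
    ext k
    simp only [Function.comp, pow_succ, Complex.I_pow_two_mul, mul_right_comm _ Complex.I,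
        ← Complex.ofReal_mul, Complex.im_ofReal_mul, Complex.I_im]
    ring
  · intro n hn
    obtain ⟨k, rfl | rfl⟩ := n.even_or_odd'
    · simp only [Complex.I_pow_two_mul, ← Complex.ofReal_mul, Complex.ofReal_im]
    · exact absurd ⟨k, rfl⟩ hn

theorem HasSum.abs_sub_sum_range_le {f g : ℕ → ℝ} {s G : ℝ} {N : ℕ} (hf : HasSum f s)
    (hg : HasSum g G) (h : ∀ k, |f (k + N)| ≤ g k) :
    |s - ∑ k ∈ Finset.range N, f k| ≤ G :=
  ((hasSum_nat_add_iff' N).2 hf).norm_le_of_bounded hg h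

theorem pow_div_factorial_add_le {v : ℝ} (hv : 0 ≤ v) (n k : ℕ) :
    v ^ (n + k) / (n + k).factorial ≤ v ^ n / n.factorial * (v ^ k / k.factorial) := by
  rw [div_mul_div_comm, ← pow_add]
  have h : ((n.factorial : ℝ) * k.factorial) ≤ (n + k).factorial := by
    exact_mod_cast Nat.le_of_dvd (Nat.factorial_pos _)
      (Nat.factorial_mul_factorial_dvd_factorial_add n k)
  have h1 : (0 : ℝ) < n.factorial := by exact_mod_cast n.factorial_pos
  have h2 : (0 : ℝ) < k.factorial := by exact_mod_cast k.factorial_pos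
  gcongr

theorem besselI_nonneg (n : ℕ) {y : ℝ} (hy : 0 ≤ y) : 0 ≤ besselI n y :=
  tsum_nonneg fun k => by positivity

theorem besselI_le (n : ℕ) {y : ℝ} (hy : 0 ≤ y) (hn : y / 2 ≤ n) :
    besselI n y ≤ (y / 2) ^ n / n.factorial * Real.exp (y / 2) := by
  refine hasSum_le (fun k => ?_) (summable_bessel_series n (y / 2)).hasSum
    ((Real.hasSum_pow_div_factorial (y / 2)).mul_left _)
  rw [div_mul_div_comm, two_mul, ← add_assoc, pow_add, pow_add]
  have h1 : (0 : ℝ) < n.factorial := by exact_mod_cast n.factorial_pos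
  have h2 : (0 : ℝ) < k.factorial := by exact_mod_cast k.factorial_pos
  have h3 : (0 : ℝ) < (n + k).factorial := by exact_mod_cast (n + k).factorial_pos
  have h : (n.factorial : ℝ) * (y / 2) ^ k ≤ (n + k).factorial := by
    refine le_trans ?_ (Nat.cast_le.2 (Nat.factorial_mul_pow_le_factorial (m := n) (n := k)))
    push_cast
    gcongr
    linarith
  rw [div_le_div_iff₀ (by positivity) (by positivity)]
  have h0 : 0 ≤ (y / 2) ^ n * (y / 2) ^ k * k.factorial := by positivity
  nlinarith [mul_le_mul_of_nonneg_left h h0]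

theorem abs_gaussTrunc_sub_exp_le {M x : ℝ} (hM : 0 ≤ M) (hx : x ∈ Set.Icc (-1 : ℝ) 1) (R : ℕ)
    (hR : M / 4 ≤ R + 1) :
    |gaussTrunc R M x - Real.exp (-M * x ^ 2)| ≤ 2 * ((M / 4) ^ (R + 1) / (R + 1).factorial) := by
  obtain ⟨θ, rfl⟩ : ∃ θ, Real.cos θ = x := ⟨_, Real.cos_arccos hx.1 hx.2⟩
  have htail := (hasSum_besselI_cos (M / 2) (2 * θ)).abs_sub_sum_range_le (N := R + 1)
    ((Real.hasSum_pow_div_factorial (M / 4)).mul_left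
      (2 * ((M / 4) ^ (R + 1) / (R + 1).factorial * Real.exp (M / 4)))) (fun k => by
    rw [abs_mul, abs_mul, abs_mul, abs_pow, abs_neg, abs_one, one_pow, one_mul, abs_two,
      abs_of_nonneg (besselI_nonneg _ (by positivity))]
    have h1 := besselI_le (k + (R + 1)) (y := M / 2) (by positivity) (by
      push_cast
      have : (0 : ℝ) ≤ k := k.cast_nonneg
      linarith)
    rw [show M / 2 / 2 = M / 4 by ring, add_comm k (R + 1)] at h1
    have h2 := mul_le_mul_of_nonneg_right
      (pow_div_factorial_add_le (v := M / 4) (by positivity) (R + 1) k) (Real.exp_pos (M / 4)).le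
    rw [add_comm k (R + 1)]
    have h3 := mul_le_mul (h1.trans h2) (Real.abs_cos_le_one ((R + 1 + k : ℕ) * (2 * θ)))
      (abs_nonneg _) (by positivity)
    linarith)
  have hsum : gaussTrunc R M (Real.cos θ) - Real.exp (-M * Real.cos θ ^ 2) =
      -(Real.exp (-M / 2) * (Real.exp (-(M / 2) * Real.cos (2 * θ)) + besselI 0 (M / 2) -
        ∑ n ∈ Finset.range (R + 1),
          (-1) ^ n * besselI n (M / 2) * (2 * Real.cos (n * (2 * θ))))) := by
    have hexp : Real.exp (-M * Real.cos θ ^ 2) =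
        Real.exp (-M / 2) * Real.exp (-(M / 2) * Real.cos (2 * θ)) := by
      rw [← Real.exp_add, Real.cos_two_mul]
      ring_nf
    have hT (n : ℕ) : (Chebyshev.T ℝ (2 * n : ℤ)).eval (Real.cos θ) =
        Real.cos (n * (2 * θ)) := by
      rw [Chebyshev.T_real_cos]
      push_cast
      ring_nf
    rw [gaussTrunc, hexp, Finset.range_eq_Ico,
      Finset.sum_eq_sum_Ico_succ_bot (Nat.succ_pos R), ← Finset.Ico_succ_right_eq_Icc]
    simp only [hT, Finset.mul_sum, mul_add, mul_sub, zero_add, Nat.succ_eq_succ]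
    simp only [mul_left_comm _ (2 : ℝ), ← Finset.mul_sum, mul_assoc, ← mul_add]
    simp
    ring
  rw [hsum, abs_neg, abs_mul, abs_of_pos (Real.exp_pos _)]
  refine (mul_le_mul_of_nonneg_left htail (Real.exp_pos _).le).trans_eq ?_
  have : Real.exp (-M / 2) * (Real.exp (M / 4) * Real.exp (M / 4)) = 1 := by
    rw [← Real.exp_add, ← Real.exp_add, ← Real.exp_zero]
    ring_nf
  linear_combination (2 * ((M / 4) ^ (R + 1) / (R + 1).factorial)) * this

theorem pow_div_factorial_add_le_half_pow {v : ℝ} (hv : 0 ≤ v) {n : ℕ} (hn : v ≤ n / 2) (j : ℕ) :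
    v ^ (n + j) / (n + j).factorial ≤ v ^ n / n.factorial * (1 / 2) ^ j := by
  have h1 : (0 : ℝ) < n.factorial := by exact_mod_cast n.factorial_pos
  have h : (n.factorial : ℝ) * (2 * v) ^ j ≤ (n + j).factorial := by
    refine le_trans ?_ (Nat.cast_le.2 (Nat.factorial_mul_pow_le_factorial (m := n) (n := j)))
    push_cast
    gcongr
    linarith
  rw [div_pow, one_pow, div_mul_div_comm, mul_one, pow_add,
    div_le_div_iff₀ (by positivity) (by positivity)]
  calc v ^ n * v ^ j * (n.factorial * 2 ^ j) = v ^ n * (n.factorial * (2 * v) ^ j) := by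
        rw [mul_pow]; ring
    _ ≤ v ^ n * (n + j).factorial := by gcongr

theorem hasSum_quarter_pow : HasSum (fun k : ℕ => (1 / 4 : ℝ) ^ k) (4 / 3) := by
  convert hasSum_geometric_of_lt_one (r := (1 / 4 : ℝ)) (by norm_num) (by norm_num) using 1
  norm_num

theorem abs_besselJ_add_le {M : ℝ} (hM : 0 ≤ M) {n : ℕ} (hn : M ≤ n) {j k : ℕ}
    (hjk : 2 * k ≤ j) :
    |besselJ (n + j) M| ≤ (M / 2) ^ n / n.factorial * (1 / 4) ^ k := by
  refine (abs_besselJ_le _ hM).trans ((pow_div_factorial_add_le_half_pow (by positivity)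
    (by linarith) j).trans (mul_le_mul_of_nonneg_left ?_ (by positivity)))
  rw [show (1 / 4 : ℝ) = (1 / 2) ^ 2 by norm_num, ← pow_mul]
  exact pow_le_pow_of_le_one (by norm_num) (by norm_num) hjk

theorem abs_jaCos_sub_cos_le {M x : ℝ} (hM : 0 ≤ M) (hx : x ∈ Set.Icc (-1 : ℝ) 1) (R : ℕ)
    (hR : M ≤ (2 * R + 2 : ℕ)) :
    |jaCos R M x - Real.cos (M * x)| ≤
      8 / 3 * ((M / 2) ^ (2 * R + 2) / (2 * R + 2).factorial) := by
  obtain ⟨θ, rfl⟩ : ∃ θ, Real.cos θ = x := ⟨_, Real.cos_arccos hx.1 hx.2⟩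
  have htail := (hasSum_besselJ_even M θ).abs_sub_sum_range_le (N := R + 1)
    (hasSum_quarter_pow.mul_left (2 * ((M / 2) ^ (2 * R + 2) / (2 * R + 2).factorial)))
    (fun k => by
      rw [abs_mul, abs_mul, abs_mul, abs_pow, abs_neg, abs_one, one_pow, one_mul, abs_two,
        show 2 * (k + (R + 1)) = 2 * R + 2 + 2 * k by ring]
      have h := mul_le_mul (abs_besselJ_add_le hM hR (le_refl (2 * k)))
        (Real.abs_cos_le_one ((2 * R + 2 + 2 * k : ℕ) * θ)) (abs_nonneg _) (by positivity)
      linarith)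
  have hT (k : ℕ) : (Chebyshev.T ℝ (2 * k : ℤ)).eval (Real.cos θ) =
      Real.cos ((2 * k : ℕ) * θ) := by
    rw [Chebyshev.T_real_cos]
    push_cast
    rfl
  have hsum : jaCos R M (Real.cos θ) = -besselJ 0 M +
      ∑ k ∈ Finset.range (R + 1),
        (-1) ^ k * besselJ (2 * k) M * (2 * Real.cos ((2 * k : ℕ) * θ)) := by
    rw [jaCos, Finset.range_eq_Ico, Finset.sum_eq_sum_Ico_succ_bot (Nat.succ_pos R),
      ← Finset.Ico_succ_right_eq_Icc]
    simp only [hT, zero_add, Nat.succ_eq_succ, mul_left_comm _ (2 : ℝ), ← Finset.mul_sum]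
    simp
    ring
  rw [hsum, abs_sub_comm]
  refine le_trans (le_of_eq ?_) (htail.trans_eq (by ring))
  congr 1
  ring

theorem abs_jaSin_sub_sin_le {M x : ℝ} (hM : 0 ≤ M) (hx : x ∈ Set.Icc (-1 : ℝ) 1) (R : ℕ)
    (hR : M ≤ (2 * R + 2 : ℕ)) :
    |jaSin R M x - Real.sin (M * x)| ≤
      8 / 3 * ((M / 2) ^ (2 * R + 2) / (2 * R + 2).factorial) := by
  obtain ⟨θ, rfl⟩ : ∃ θ, Real.cos θ = x := ⟨_, Real.cos_arccos hx.1 hx.2⟩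
  have htail := (hasSum_besselJ_odd M θ).abs_sub_sum_range_le (N := R + 1)
    (hasSum_quarter_pow.mul_left (2 * ((M / 2) ^ (2 * R + 2) / (2 * R + 2).factorial)))
    (fun k => by
      rw [abs_mul, abs_mul, abs_mul, abs_pow, abs_neg, abs_one, one_pow, one_mul, abs_two,
        show 2 * (k + (R + 1)) + 1 = 2 * R + 2 + (2 * k + 1) by ring]
      have h := mul_le_mul (abs_besselJ_add_le hM hR (Nat.le_succ (2 * k)))
        (Real.abs_cos_le_one ((2 * R + 2 + (2 * k + 1) : ℕ) * θ)) (abs_nonneg _) (by positivity)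
      linarith)
  have hT (k : ℕ) : (Chebyshev.T ℝ (2 * k + 1 : ℤ)).eval (Real.cos θ) =
      Real.cos ((2 * k + 1 : ℕ) * θ) := by
    rw [Chebyshev.T_real_cos]
    push_cast
    rfl
  have hsum : jaSin R M (Real.cos θ) = ∑ k ∈ Finset.range (R + 1),
        (-1) ^ k * besselJ (2 * k + 1) M * (2 * Real.cos ((2 * k + 1 : ℕ) * θ)) := by
    simp only [jaSin, hT, mul_left_comm _ (2 : ℝ), ← Finset.mul_sum]
  rw [hsum, abs_sub_comm]
  exact htail.trans_eq (by ring)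

theorem mul_div_exp_one_pow_le_factorial {c : ℝ} {a n : ℕ} (ha : 1 ≤ a) (hn : a ≤ n)
    (hc : 0 ≤ c) (h : c * (a / Real.exp 1) ^ a ≤ a.factorial) :
    c * (n / Real.exp 1) ^ n ≤ n.factorial := by
  induction n, hn using Nat.le_induction with
  | base => exact h
  | succ n hn ih =>
    have hn0 : (0 : ℝ) < n := by exact_mod_cast ha.trans hn
    have he := Real.exp_pos 1
    have hpow : ((n : ℝ) + 1) ^ n ≤ Real.exp 1 * (n : ℝ) ^ n := by
      have h1 := pow_le_pow_left₀ (by positivity) (Real.add_one_le_exp (1 / (n : ℝ))) n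
      rw [← Real.exp_nat_mul, mul_one_div_cancel hn0.ne', div_add_one hn0.ne', div_pow,
        div_le_iff₀ (by positivity), add_comm] at h1
      exact h1
    rw [Nat.factorial_succ]
    push_cast
    calc c * (((n : ℝ) + 1) / Real.exp 1) ^ (n + 1)
        = (n + 1) * (c / Real.exp 1 ^ (n + 1)) * (n + 1) ^ n := by
          rw [div_pow, pow_succ ((n : ℝ) + 1)]; ring
      _ ≤ (n + 1) * (c / Real.exp 1 ^ (n + 1)) * (Real.exp 1 * (n : ℝ) ^ n) := by gcongr
      _ = (n + 1) * (c * (n / Real.exp 1) ^ n) := by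
          rw [div_pow, pow_succ (Real.exp 1)]
          field_simp
      _ ≤ (n + 1) * n.factorial := by gcongr

theorem div_pow_le_div_rpow {t r : ℝ} {n : ℕ} (ht : 0 < t) (hr : t < r) (hn : r ≤ n) :
    (t / n) ^ n ≤ (t / r) ^ r := by
  have hr0 := ht.trans hr
  calc (t / n) ^ n ≤ (t / r) ^ n := by gcongr
    _ = (t / r) ^ (n : ℝ) := (Real.rpow_natCast _ _).symm
    _ ≤ (t / r) ^ r := Real.rpow_le_rpow_of_exponent_ge (by positivity)
        ((div_le_one hr0).2 hr.le) hn

theorem mul_pow_div_factorial_le {c v r : ℝ} {a n : ℕ} (ha : 1 ≤ a) (hn : a ≤ n) (hc : 0 ≤ c)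
    (h : c * (a / Real.exp 1) ^ a ≤ a.factorial) (hv : 0 < v) (hr : Real.exp 1 * v < r)
    (hrn : r ≤ n) :
    c * (v ^ n / n.factorial) ≤ (Real.exp 1 * v / r) ^ r := by
  refine le_trans ?_ (div_pow_le_div_rpow (by positivity) hr hrn)
  have hf := mul_div_exp_one_pow_le_factorial ha hn hc h
  have hn0 : (0 : ℝ) < n := by exact_mod_cast ha.trans hn
  have h1 : (0 : ℝ) < n.factorial := by exact_mod_cast n.factorial_pos
  rw [← mul_div_assoc, div_le_iff₀ h1]
  calc c * v ^ n = (Real.exp 1 * v / n) ^ n * (c * (n / Real.exp 1) ^ n) := by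
        rw [mul_left_comm, ← mul_pow]
        congr 2
        field_simp
    _ ≤ (Real.exp 1 * v / n) ^ n * n.factorial := by gcongr

theorem abs_mul_sub_mul_le {E e C c ε : ℝ} (hε0 : 0 ≤ ε) (hε : ε ≤ 1) (hE : |E - e| ≤ ε / 3)
    (hC : |C - c| ≤ ε / 2) (he : |e| ≤ 1) (hc : |c| ≤ 1) : |E * C - e * c| ≤ ε := by
  have h1 : |C| ≤ 1 + ε / 2 := by
    have := abs_sub_abs_le_abs_sub C c
    linarith
  have h2 : |E * C - e * c| ≤ |E - e| * |C| + |e| * |C - c| := by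
    rw [← abs_mul, ← abs_mul]
    refine le_trans (le_of_eq ?_) (abs_add_le _ _)
    ring_nf
  have h3 := mul_le_mul hE h1 (abs_nonneg _) (by linarith)
  have h4 := mul_le_mul he hC (abs_nonneg _) zero_le_one
  nlinarith

/-- Polynomial approximation of `e^{−M₁x²}cos(M₂x)` and `e^{−M₁x²}sin(M₂x)`: with
`R₁ = ⌊r(eM₁/4, 5ε/12)⌋` and `R₂ = ⌊r(eM₂/2, 5ε/8)/2⌋`, the products of the truncated
expansions are `ε`-close on `[−1,1]`. -/
theorem poly_approx_combined (M₁ M₂ ε : ℝ) (hM₁ : 0 < M₁) (hM₂ : 0 < M₂)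
    (hε : ε ∈ Set.Ioo (0 : ℝ) 1)
    (r₁ : ℝ) (hr₁ : Real.exp 1 * M₁ / 4 < r₁)
    (hreq₁ : (Real.exp 1 * M₁ / 4 / r₁) ^ r₁ = 5 * ε / 12)
    (r₂ : ℝ) (hr₂ : Real.exp 1 * M₂ / 2 < r₂)
    (hreq₂ : (Real.exp 1 * M₂ / 2 / r₂) ^ r₂ = 5 * ε / 8)
    (R₁ R₂ : ℕ) (hR₁ : R₁ = ⌊r₁⌋₊) (hR₂ : R₂ = ⌊r₂ / 2⌋₊) :
    ∀ x ∈ Set.Icc (-1 : ℝ) 1,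
      |gaussTrunc R₁ M₁ x * jaCos R₂ M₂ x -
          Real.exp (-M₁ * x ^ 2) * Real.cos (M₂ * x)| ≤ ε ∧
      |gaussTrunc R₁ M₁ x * jaSin R₂ M₂ x -
          Real.exp (-M₁ * x ^ 2) * Real.sin (M₂ * x)| ≤ ε := by
  intro x hx
  have he := Real.exp_one_gt_d9
  have hN₁ : r₁ ≤ (R₁ + 1 : ℕ) := by
    subst hR₁
    push_cast
    exact (Nat.lt_floor_add_one r₁).le
  have hN₂ : r₂ ≤ (2 * R₂ + 2 : ℕ) := by
    subst hR₂
    push_cast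
    linarith [Nat.lt_floor_add_one (r₂ / 2)]
  have hE : |gaussTrunc R₁ M₁ x - Real.exp (-M₁ * x ^ 2)| ≤ ε / 3 := by
    have h1 := abs_gaussTrunc_sub_exp_le hM₁.le hx R₁ (by push_cast at hN₁; nlinarith)
    have h2 := mul_pow_div_factorial_le (c := Real.exp 1) (v := M₁ / 4) (r := r₁) (a := 1)
      (n := R₁ + 1) le_rfl (by omega) (Real.exp_pos 1).le
      (by simp) (by positivity) (by linarith) hN₁
    rw [← mul_div_assoc (Real.exp 1) M₁, hreq₁] at h2
    have h3 : 0 ≤ (M₁ / 4) ^ (R₁ + 1) / ((R₁ + 1).factorial : ℝ) := by positivity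
    nlinarith
  have hδ : 8 / 3 * ((M₂ / 2) ^ (2 * R₂ + 2) / ((2 * R₂ + 2).factorial : ℝ)) ≤ ε / 2 := by
    have h2 := mul_pow_div_factorial_le (c := 10 / 3) (v := M₂ / 2) (r := r₂) (a := 2)
      (n := 2 * R₂ + 2) one_le_two (by omega) (by norm_num)
      (by
        rw [div_pow, ← mul_div_assoc, div_le_iff₀ (by positivity), Nat.factorial_two]
        push_cast
        nlinarith) (by positivity) (by linarith) hN₂
    rw [← mul_div_assoc (Real.exp 1) M₂, hreq₂] at h2
    linarith
  have hM : M₂ ≤ (2 * R₂ + 2 : ℕ) := by nlinarith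
  have hexp : |Real.exp (-M₁ * x ^ 2)| ≤ 1 := by
    rw [Real.abs_exp, Real.exp_le_one_iff]
    nlinarith [mul_nonneg hM₁.le (sq_nonneg x)]
  exact ⟨abs_mul_sub_mul_le hε.1.le hε.2.le hE ((abs_jaCos_sub_cos_le hM₂.le hx R₂ hM).trans hδ)
      hexp (Real.abs_cos_le_one _),
    abs_mul_sub_mul_le hε.1.le hε.2.le hE ((abs_jaSin_sub_sin_le hM₂.le hx R₂ hM).trans hδ)
      hexp (Real.abs_sin_le_one _)⟩
end

section
/- Let p be a positive integer and α_j = 2(−1)^{j+1}(p!)²/((p+j)!(p−j)!) for 1 ≤ j ≤ p. Then for every h ∈ ℝ, Σ_{j=1}^p α_j cos(jh) = 1 − 2^{2p} · binom(2p, p)^{−1} · sin(h/2)^{2p}. -/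
open Real

/-- The finite-difference coefficients `α_j = 2(−1)^{j+1}(p!)²/((p+j)!(p−j)!)`. -/
noncomputable def fdAlpha (p j : ℕ) : ℝ :=
  2 * (-1 : ℝ) ^ (j + 1) * (p.factorial : ℝ) ^ 2 /
    ((p + j).factorial * (p - j).factorial)

/-- Folding a sum over `0, …, 2p` about its middle term. -/
theorem sum_range_two_mul_add_one_eq_fold {M : Type*} [AddCommMonoid M] (f : ℕ → M) (p : ℕ) :
    ∑ m ∈ Finset.range (2 * p + 1), f m =
      f p + ∑ j ∈ Finset.Icc 1 p, (f (p + j) + f (p - j)) := by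
  have hIcc : Finset.Icc 1 p = Finset.Ico 1 (p + 1) := by rfl
  rw [show 2 * p + 1 = p + (p + 1) by ring, Finset.sum_range_add, Finset.sum_range_succ',
    ← Finset.sum_range_reflect, hIcc, Finset.sum_Ico_eq_sum_range, Finset.sum_add_distrib,
    add_tsub_cancel_right, add_zero]
  have h₁ : ∀ k, f (p - 1 - k) = f (p - (1 + k)) := fun k => by rw [Nat.sub_sub]
  have h₂ : ∀ k, f (p + (k + 1)) = f (p + (1 + k)) := fun k => by rw [add_comm k]
  simp only [h₁, h₂]
  abel

/-- The Fourier expansion of an even power of `sin (h / 2)`. -/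
theorem two_pow_mul_sin_half_pow_eq_sum (p : ℕ) (h : ℝ) :
    (-1) ^ p * 2 ^ (2 * p) * sin (h / 2) ^ (2 * p) =
      ∑ m ∈ Finset.range (2 * p + 1),
        (-1) ^ m * (Nat.choose (2 * p) m : ℝ) * cos (((m : ℝ) - p) * h) := by
  have key : (((-1) ^ p * 2 ^ (2 * p) * sin (h / 2) ^ (2 * p) : ℝ) : ℂ) =
      ∑ m ∈ Finset.range (2 * p + 1), (((-1) ^ m * (Nat.choose (2 * p) m : ℝ) : ℝ) : ℂ) *
        Complex.exp (((((m : ℝ) - p) * h : ℝ) : ℂ) * Complex.I) := by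
    have hsin : Complex.exp ((h / 2 : ℝ) * Complex.I) - Complex.exp (-(h / 2 : ℝ) * Complex.I) =
        2 * Complex.I * (sin (h / 2) : ℝ) := by
      rw [Complex.ofReal_sin, Complex.exp_mul_I, Complex.exp_mul_I, Complex.cos_neg,
        Complex.sin_neg]
      ring
    calc
      _ = (2 * Complex.I * (sin (h / 2) : ℝ)) ^ (2 * p) := by
        rw [mul_pow, mul_pow, pow_mul Complex.I, Complex.I_sq]
        push_cast
        ring
      _ = _ := by
        rw [← hsin, sub_pow]
        refine Finset.sum_congr rfl fun m hm => ?_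
        have hm' : m ≤ 2 * p := Nat.lt_succ_iff.mp (Finset.mem_range.mp hm)
        rw [mul_assoc _ (_ ^ m), ← Complex.exp_nat_mul, ← Complex.exp_nat_mul, ← Complex.exp_add,
          pow_add, pow_mul, neg_one_sq, one_pow, mul_one, mul_right_comm]
        push_cast [Nat.cast_sub hm']
        congr 2
        ring
  have hre := congrArg Complex.re key
  simpa only [Complex.ofReal_re, Complex.re_sum, Complex.re_ofReal_mul,
    Complex.exp_ofReal_mul_I_re] using hre

/-- The coefficients `α_j` are normalised binomial coefficients. -/
theorem fdAlpha_eq_choose {p j : ℕ} (hj : j ≤ p) :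
    fdAlpha p j =
      2 * (-1) ^ (j + 1) * (Nat.choose (2 * p) (p + j) : ℝ) * (Nat.choose (2 * p) p : ℝ)⁻¹ := by
  rw [fdAlpha, Nat.cast_choose ℝ (show p + j ≤ 2 * p by omega),
    Nat.cast_choose ℝ (show p ≤ 2 * p by omega), show 2 * p - (p + j) = p - j by omega,
    show 2 * p - p = p by omega]
  have h₁ := Nat.cast_ne_zero (R := ℝ).mpr (2 * p).factorial_ne_zero
  field_simp

/-- The trigonometric identity
`Σ_{j=1}^p α_j cos(jh) = 1 − 2^{2p} binom(2p,p)⁻¹ sin(h/2)^{2p}`. -/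
theorem alpha_cos_identity (p : ℕ) (hp : 1 ≤ p) (h : ℝ) :
    ∑ j ∈ Finset.Icc 1 p, fdAlpha p j * Real.cos (j * h) =
      1 - 2 ^ (2 * p) * ((Nat.choose (2 * p) p : ℝ))⁻¹ * Real.sin (h / 2) ^ (2 * p) := by
  have hC : (Nat.choose (2 * p) p : ℝ) ≠ 0 :=
    Nat.cast_ne_zero.mpr (Nat.choose_pos (by omega)).ne'
  have hsq : ((-1 : ℝ) ^ p) * (-1) ^ p = 1 := by rw [← mul_pow]; simp
  have hsin := two_pow_mul_sin_half_pow_eq_sum p h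
  rw [sum_range_two_mul_add_one_eq_fold, sub_self, zero_mul, cos_zero, mul_one] at hsin
  have hfold : ∑ j ∈ Finset.Icc 1 p,
      ((-1) ^ (p + j) * (Nat.choose (2 * p) (p + j) : ℝ) * cos (((p + j : ℕ) - (p : ℝ)) * h) +
        (-1) ^ (p - j) * (Nat.choose (2 * p) (p - j) : ℝ) * cos (((p - j : ℕ) - (p : ℝ)) * h)) =
      -((-1) ^ p * (Nat.choose (2 * p) p : ℝ)) *
        ∑ j ∈ Finset.Icc 1 p, fdAlpha p j * cos (j * h) := by
    rw [Finset.mul_sum]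
    refine Finset.sum_congr rfl fun j hj => ?_
    have hjp : j ≤ p := (Finset.mem_Icc.mp hj).2
    have hsign : (-1 : ℝ) ^ (p - j) = (-1) ^ (p + j) := by
      rw [show p + j = p - j + 2 * j by omega, pow_add, pow_mul]
      simp
    have hcos : cos (((p : ℝ) - j - p) * h) = cos (j * h) := by
      rw [← cos_neg]
      congr 1
      ring
    rw [fdAlpha_eq_choose hjp, hsign,
      Nat.choose_symm_of_eq_add (show 2 * p = p - j + (p + j) by omega), Nat.cast_sub hjp, hcos,
      Nat.cast_add, add_sub_cancel_left]
    field_simp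
    ring
  rw [hfold] at hsin
  field_simp
  linear_combination (-1) ^ p * hsin +
    (Nat.choose (2 * p) p * (1 - ∑ j ∈ Finset.Icc 1 p, fdAlpha p j * cos (j * h)) -
      2 ^ (2 * p) * sin (h / 2) ^ (2 * p)) * hsq
end

section
/- Fix an integer p ≥ 1, d > 0, a positive integer N, Δx = d/N and ω = 2π/d, and let λ(k) = Σ_{j=1}^p α_j sin(ωkjΔx)/(jΔx) and μ(k) = Σ_{j=1}^p α_j (2 − 2cos(ωkjΔx))/(jΔx)² with α_j = 2(−1)^{j+1}(p!)²/((p+j)!(p−j)!). Then λ(k) ≥ 0 for every real k ∈ [0, N/2], λ(k) ≤ 0 for every real k ∈ [−N/2, 0], and μ is monotone increasing on [0, N/2] and monotone decreasing on [−N/2, 0] (i.e., μ(k) ≤ μ(k') whenever 0 ≤ k ≤ k' ≤ N/2, and μ(k') ≤ μ(k) whenever −N/2 ≤ k ≤ k' ≤ 0). -/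
open Real

/-- The eigenvalue symbol `λ(k) = Σ_{j=1}^p α_j sin(ωkjΔx)/(jΔx)` of `D_{2p}`. -/
noncomputable def fdLambda (p : ℕ) (ω Δx : ℝ) (k : ℝ) : ℝ :=
  ∑ j ∈ Finset.Icc 1 p, fdAlpha p j * Real.sin (ω * k * j * Δx) / (j * Δx)

/-- The eigenvalue symbol `μ(k) = Σ_{j=1}^p α_j (2 − 2cos(ωkjΔx))/(jΔx)²` of `D^{(2)}_{2p}`. -/
noncomputable def fdMu (p : ℕ) (ω Δx : ℝ) (k : ℝ) : ℝ :=
  ∑ j ∈ Finset.Icc 1 p, fdAlpha p j * (2 - 2 * Real.cos (ω * k * j * Δx)) / (j * Δx) ^ 2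

/-- The symbol of `D_{2p}` for `Δx = 1` as a function of the angle `θ = ωkΔx`. -/
noncomputable def sinSymbol (p : ℕ) (θ : ℝ) : ℝ :=
  ∑ j ∈ Finset.Icc 1 p, fdAlpha p j * Real.sin (j * θ) / j

/-- The symbol of `D^{(2)}_{2p}` for `Δx = 1` as a function of the angle `θ = ωkΔx`. -/
noncomputable def cosSymbol (p : ℕ) (θ : ℝ) : ℝ :=
  ∑ j ∈ Finset.Icc 1 p, fdAlpha p j * (2 - 2 * Real.cos (j * θ)) / (j : ℝ) ^ 2

lemma fdLambda_eq (p : ℕ) (ω Δx k : ℝ) :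
    fdLambda p ω Δx k = sinSymbol p (ω * k * Δx) / Δx := by
  unfold fdLambda sinSymbol
  rw [Finset.sum_div]
  refine Finset.sum_congr rfl fun j _ => ?_
  rw [div_div, show ω * k * j * Δx = j * (ω * k * Δx) by ring]

lemma fdMu_eq (p : ℕ) (ω Δx k : ℝ) :
    fdMu p ω Δx k = cosSymbol p (ω * k * Δx) / Δx ^ 2 := by
  unfold fdMu cosSymbol
  rw [Finset.sum_div]
  refine Finset.sum_congr rfl fun j _ => ?_
  rw [div_div, mul_pow, show ω * k * j * Δx = j * (ω * k * Δx) by ring]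

lemma sinSymbol_neg (p : ℕ) (θ : ℝ) : sinSymbol p (-θ) = -sinSymbol p θ := by
  simp [sinSymbol, neg_div]

lemma cosSymbol_neg (p : ℕ) (θ : ℝ) : cosSymbol p (-θ) = cosSymbol p θ := by
  simp [cosSymbol]

lemma sinSymbol_zero (p : ℕ) : sinSymbol p 0 = 0 := by
  simp [sinSymbol]

lemma sinSymbol_pi (p : ℕ) : sinSymbol p π = 0 := by
  simp [sinSymbol, Real.sin_nat_mul_pi]

lemma hasDerivAt_sinSymbol (p : ℕ) (θ : ℝ) :
    HasDerivAt (sinSymbol p) (∑ j ∈ Finset.Icc 1 p, fdAlpha p j * Real.cos (j * θ)) θ := by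
  unfold sinSymbol
  refine HasDerivAt.fun_sum fun j hj => ?_
  have hj0 : (j : ℝ) ≠ 0 := by
    have := (Finset.mem_Icc.1 hj).1
    positivity
  have h := ((((hasDerivAt_id θ).const_mul (j : ℝ)).sin).const_mul (fdAlpha p j)).div_const (j : ℝ)
  refine h.congr_deriv ?_
  simp only [id]
  field_simp

lemma hasDerivAt_cosSymbol (p : ℕ) (θ : ℝ) :
    HasDerivAt (cosSymbol p) (2 * sinSymbol p θ) θ := by
  unfold cosSymbol sinSymbol
  rw [Finset.mul_sum]
  refine HasDerivAt.fun_sum fun j hj => ?_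
  have hj0 : (j : ℝ) ≠ 0 := by
    have := (Finset.mem_Icc.1 hj).1
    positivity
  have h := ((((((hasDerivAt_id θ).const_mul (j : ℝ)).cos).const_mul 2).const_sub 2).const_mul
    (fdAlpha p j)).div_const ((j : ℝ) ^ 2)
  refine h.congr_deriv ?_
  simp only [id]
  field_simp

/-- Binomial expansion of `(2 - 2 cos θ) ^ p` as a cosine polynomial, over all `2p + 1` modes. -/
lemma two_sub_two_cos_pow (p : ℕ) (θ : ℝ) :
    (2 - 2 * Real.cos θ) ^ p =
      ∑ m ∈ Finset.range (2 * p + 1),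
        (-1 : ℝ) ^ (m + p) * (2 * p).choose m * Real.cos (((m : ℝ) - p) * θ) := by
  have hz : ∀ m : ℕ, Complex.exp (((m : ℝ) - p : ℝ) * θ * Complex.I) =
      Complex.exp (θ * Complex.I) ^ m * Complex.exp (-(θ * Complex.I)) ^ p := by
    intro m
    rw [← Complex.exp_nat_mul, ← Complex.exp_nat_mul, ← Complex.exp_add]
    congr 1
    push_cast
    ring
  have hinv : Complex.exp (θ * Complex.I) * Complex.exp (-(θ * Complex.I)) = 1 := by
    rw [← Complex.exp_add, add_neg_cancel, Complex.exp_zero]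
  have hcos : 2 * Complex.cos θ = Complex.exp (θ * Complex.I) + Complex.exp (-(θ * Complex.I)) := by
    rw [Complex.two_cos, neg_mul]
  have key : (((2 - 2 * Real.cos θ) ^ p : ℝ) : ℂ) =
      ∑ m ∈ Finset.range (2 * p + 1),
        (((-1 : ℝ) ^ (m + p) * (2 * p).choose m : ℝ) : ℂ) *
          Complex.exp (((m : ℝ) - p : ℝ) * θ * Complex.I) := by
    simp only [hz]
    push_cast
    rw [hcos]
    set z := Complex.exp (θ * Complex.I)
    set w := Complex.exp (-(θ * Complex.I))
    have hsq : 2 - (z + w) = (-z + 1) ^ 2 * (-w) := by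
      linear_combination (z - 2) * hinv
    rw [hsq, mul_pow, ← pow_mul, add_pow, Finset.sum_mul]
    refine Finset.sum_congr rfl fun m _ => ?_
    rw [neg_pow z, neg_pow w]
    ring
  have hre := congrArg Complex.re key
  rw [Complex.ofReal_re, Complex.re_sum] at hre
  rw [hre]
  refine Finset.sum_congr rfl fun m _ => ?_
  rw [Complex.re_ofReal_mul, ← Complex.ofReal_mul, Complex.exp_ofReal_mul_I_re]

lemma fdAlpha_mul_centralBinom {p j : ℕ} (hj : j ≤ p) :
    fdAlpha p j * (2 * p).choose p = -2 * ((-1) ^ j * (2 * p).choose (p + j)) := by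
  have h1 : (((2 * p).choose p : ℕ) : ℝ) = (2 * p).factorial / (p.factorial * p.factorial) := by
    rw [Nat.cast_choose ℝ (by omega), show 2 * p - p = p by omega]
  have h2 : (((2 * p).choose (p + j) : ℕ) : ℝ) =
      (2 * p).factorial / ((p + j).factorial * (p - j).factorial) := by
    rw [Nat.cast_choose ℝ (by omega), show 2 * p - (p + j) = p - j by omega]
  have hp : (p.factorial : ℝ) ≠ 0 := by positivity
  have ha : ((p + j).factorial : ℝ) ≠ 0 := by positivity
  have hb : ((p - j).factorial : ℝ) ≠ 0 := by positivity
  rw [h1, h2, fdAlpha]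
  field_simp
  ring

lemma sum_fdAlpha_mul_cos (p : ℕ) (θ : ℝ) :
    ∑ j ∈ Finset.Icc 1 p, fdAlpha p j * Real.cos (j * θ) =
      1 - (2 - 2 * Real.cos θ) ^ p / (2 * p).choose p := by
  have hc : (((2 * p).choose p : ℕ) : ℝ) ≠ 0 := by
    exact_mod_cast (Nat.choose_pos (by omega)).ne'
  have hsq : ((-1 : ℝ) ^ p) * (-1) ^ p = 1 := by rw [← mul_pow]; simp
  have hexp : (2 - 2 * Real.cos θ) ^ p = (2 * p).choose p +
      2 * ∑ j ∈ Finset.range p,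
        (-1 : ℝ) ^ (j + 1) * (2 * p).choose (p + (j + 1)) * Real.cos (((j + 1 : ℕ) : ℝ) * θ) := by
    rw [two_sub_two_cos_pow, show 2 * p + 1 = p + (p + 1) by ring, Finset.sum_range_add,
      Finset.sum_range_succ', ← Finset.sum_range_reflect, two_mul (Finset.sum _ _)]
    have hleft : ∀ j ∈ Finset.range p,
        (-1 : ℝ) ^ (p - 1 - j + p) * (2 * p).choose (p - 1 - j) *
          Real.cos ((((p - 1 - j : ℕ) : ℝ) - p) * θ) =
        (-1 : ℝ) ^ (j + 1) * (2 * p).choose (p + (j + 1)) *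
          Real.cos (((j + 1 : ℕ) : ℝ) * θ) := by
      intro j hj
      have hj := Finset.mem_range.1 hj
      obtain ⟨q, rfl⟩ : ∃ q, p = q + (j + 1) := ⟨p - (j + 1), by omega⟩
      rw [show q + (j + 1) - 1 - j = q by omega,
        Nat.choose_symm_of_eq_add
          (show 2 * (q + (j + 1)) = q + (q + (j + 1) + (j + 1)) by ring),
        ← Real.cos_neg (((j + 1 : ℕ) : ℝ) * θ), show q + (q + (j + 1)) = 2 * q + (j + 1) by ring, pow_add, pow_mul,
        neg_one_sq, one_pow, one_mul]
      congr 2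
      push_cast
      ring
    have hright : ∀ j ∈ Finset.range p,
        (-1 : ℝ) ^ (p + (j + 1) + p) * (2 * p).choose (p + (j + 1)) *
          Real.cos ((((p + (j + 1) : ℕ) : ℝ) - p) * θ) =
        (-1 : ℝ) ^ (j + 1) * (2 * p).choose (p + (j + 1)) *
          Real.cos (((j + 1 : ℕ) : ℝ) * θ) := by
      intro j _
      rw [show p + (j + 1) + p = p + p + (j + 1) by ring, pow_add, pow_add, hsq, one_mul]
      congr 2
      push_cast
      ring
    rw [Finset.sum_congr rfl hleft, Finset.sum_congr rfl hright]
    simp [pow_add, hsq]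
    ring
  rw [hexp, add_div, div_self hc, sub_add_cancel_left, ← Finset.Ico_add_one_right_eq_Icc,
    Finset.sum_Ico_eq_sum_range, add_tsub_cancel_right, eq_neg_iff_add_eq_zero, Finset.mul_sum,
    Finset.sum_div, ← Finset.sum_add_distrib]
  refine Finset.sum_eq_zero fun j hj => ?_
  have h := fdAlpha_mul_centralBinom (p := p) (j := j + 1) (Finset.mem_range.1 hj)
  rw [add_comm 1 j]
  field_simp
  linear_combination Real.cos (((j + 1 : ℕ) : ℝ) * θ) * h

lemma concaveOn_sinSymbol (p : ℕ) : ConcaveOn ℝ (Set.Icc 0 π) (sinSymbol p) := by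
  have hd : Differentiable ℝ (sinSymbol p) := fun θ => (hasDerivAt_sinSymbol p θ).differentiableAt
  refine AntitoneOn.concaveOn_of_deriv (convex_Icc 0 π) hd.continuous.continuousOn
    hd.differentiableOn ?_
  intro x hx y hy hxy
  rw [interior_Icc] at hx hy
  rw [(hasDerivAt_sinSymbol p x).deriv, (hasDerivAt_sinSymbol p y).deriv, sum_fdAlpha_mul_cos,
    sum_fdAlpha_mul_cos]
  have hcos : Real.cos y ≤ Real.cos x := Real.cos_le_cos_of_nonneg_of_le_pi hx.1.le hy.2.le hxy
  have h0 : 0 ≤ 2 - 2 * Real.cos x := by linarith [Real.cos_le_one x]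
  gcongr

lemma sinSymbol_nonneg (p : ℕ) {θ : ℝ} (hθ : θ ∈ Set.Icc 0 π) : 0 ≤ sinSymbol p θ := by
  have h := (concaveOn_sinSymbol p).min_le_of_mem_Icc (Set.left_mem_Icc.2 Real.pi_nonneg)
    (Set.right_mem_Icc.2 Real.pi_nonneg) hθ
  simpa [sinSymbol_zero, sinSymbol_pi] using h

lemma monotoneOn_cosSymbol (p : ℕ) : MonotoneOn (cosSymbol p) (Set.Icc 0 π) := by
  have hd : Differentiable ℝ (cosSymbol p) := fun θ => (hasDerivAt_cosSymbol p θ).differentiableAt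
  refine monotoneOn_of_deriv_nonneg (convex_Icc 0 π) hd.continuous.continuousOn
    hd.differentiableOn fun θ hθ => ?_
  rw [(hasDerivAt_cosSymbol p θ).deriv]
  have := sinSymbol_nonneg p (interior_subset hθ)
  positivity

/-- Sign of `λ` and monotonicity of `μ`: `λ ≥ 0` on `[0, N/2]`, `λ ≤ 0` on `[−N/2, 0]`,
`μ` is increasing on `[0, N/2]` and decreasing on `[−N/2, 0]`. -/
theorem lambda_sign_mu_monotone (p : ℕ) (hp : 1 ≤ p) (d : ℝ) (hd : 0 < d)
    (N : ℕ) (hN : 0 < N) (ω Δx : ℝ) (hω : ω = 2 * Real.pi / d) (hΔx : Δx = d / N) :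
    (∀ k : ℝ, k ∈ Set.Icc (0 : ℝ) (N / 2) → 0 ≤ fdLambda p ω Δx k) ∧
    (∀ k : ℝ, k ∈ Set.Icc (-(N : ℝ) / 2) 0 → fdLambda p ω Δx k ≤ 0) ∧
    (∀ k k' : ℝ, 0 ≤ k → k ≤ k' → k' ≤ N / 2 → fdMu p ω Δx k ≤ fdMu p ω Δx k') ∧
    (∀ k k' : ℝ, -(N : ℝ) / 2 ≤ k → k ≤ k' → k' ≤ 0 → fdMu p ω Δx k' ≤ fdMu p ω Δx k) := by
  have hN' : (0 : ℝ) < N := by exact_mod_cast hN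
  have hx : 0 < Δx := hΔx ▸ div_pos hd hN'
  have hang : ∀ k : ℝ, ω * k * Δx = 2 * π / N * k := by
    intro k
    rw [hω, hΔx]
    field_simp
  have hmem : ∀ k : ℝ, 0 ≤ k → k ≤ N / 2 → 2 * π / N * k ∈ Set.Icc 0 π := by
    intro k h0 h1
    refine ⟨by positivity, ?_⟩
    calc 2 * π / N * k ≤ 2 * π / N * (N / 2) := by gcongr
      _ = π := by field_simp
  have hmono : ∀ k k' : ℝ, 0 ≤ k → k ≤ k' → k' ≤ N / 2 →
      cosSymbol p (2 * π / N * k) ≤ cosSymbol p (2 * π / N * k') := fun k k' h0 hkk h1 =>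
    monotoneOn_cosSymbol p (hmem k h0 (hkk.trans h1)) (hmem k' (h0.trans hkk) h1) (by gcongr)
  simp only [fdLambda_eq, fdMu_eq, hang]
  refine ⟨fun k hk => div_nonneg (sinSymbol_nonneg p (hmem k hk.1 hk.2)) hx.le,
    fun k hk => div_nonpos_of_nonpos_of_nonneg ?_ hx.le, fun k k' h0 hkk h1 => ?_,
    fun k k' h0 hkk h1 => ?_⟩
  · have h := sinSymbol_nonneg p (hmem (-k) (by linarith [hk.2]) (by linarith [hk.1]))
    rw [mul_neg, sinSymbol_neg] at h
    linarith
  · have := hmono k k' h0 hkk h1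
    gcongr
  · have := hmono (-k') (-k) (by linarith) (by linarith) (by linarith)
    rw [mul_neg, mul_neg, cosSymbol_neg, cosSymbol_neg] at this
    gcongr
end
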